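/- arXiv:2410.14565 — 3 statements merged into one kernel-verified Lean document; each statement's English description precedes it below -/
import Mathlib

section
/- Let ι be a finite type and f : Finset ι → ℝ be monotone (S ⊆ T implies f(S) ≤ f(T)) and submodular (for all S ⊆ T and x ∉ T, f(insert x S) - f(S) ≥ f(insert x T) - f(T)). Then for every finset S and every nonempty finset O of ι, there exists x ∈ O with f(insert x S) - f(S) ≥ (f(O ∪ S) - f(S)) / |O|; in particular, since f is monotone, f(insert x S) - f(S) ≥ (f(O) - f(S)) / |O|. -/
/-- The gain of adding a whole finset to `S` is at most the sum of the marginal gains at `S` of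
its elements, for a monotone submodular set function. -/
theorem union_sub_le_sum_insert_sub {ι : Type*} [DecidableEq ι] (f : Finset ι → ℝ)
    (hmono : ∀ S T : Finset ι, S ⊆ T → f S ≤ f T)
    (hsub : ∀ S T : Finset ι, S ⊆ T → ∀ x ∉ T,
      f (insert x S) - f S ≥ f (insert x T) - f T)
    (S O : Finset ι) :
    f (O ∪ S) - f S ≤ ∑ x ∈ O, (f (insert x S) - f S) := by
  induction O using Finset.induction_on with
  | empty => simp
  | insert a O ha ih =>
    rw [Finset.sum_insert ha, Finset.insert_union]
    by_cases h : a ∈ O ∪ S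
    · rw [Finset.insert_eq_of_mem h]
      linarith [hmono S (insert a S) (Finset.subset_insert a S)]
    · linarith [hsub S (O ∪ S) Finset.subset_union_right a h]

/-- Key marginal-gain lemma for monotone submodular set functions: for any finset `S` and
any nonempty finset `O`, some element `x ∈ O` has marginal gain at least
`(f(O ∪ S) - f(S)) / |O|`, and in particular (by monotonicity) at least `(f(O) - f(S)) / |O|`. -/
theorem exists_marginal_gain {ι : Type*} [Fintype ι] [DecidableEq ι]
    (f : Finset ι → ℝ)
    (hmono : ∀ S T : Finset ι, S ⊆ T → f S ≤ f T)
    (hsub : ∀ S T : Finset ι, S ⊆ T → ∀ x ∉ T,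
      f (insert x S) - f S ≥ f (insert x T) - f T)
    (S O : Finset ι) (hO : O.Nonempty) :
    ∃ x ∈ O,
      f (insert x S) - f S ≥ (f (O ∪ S) - f S) / O.card ∧
      f (insert x S) - f S ≥ (f O - f S) / O.card := by
  have hcard : (0 : ℝ) < O.card := by exact_mod_cast hO.card_pos
  obtain ⟨x, hx, hgain⟩ : ∃ x ∈ O, (f (O ∪ S) - f S) / O.card ≤ f (insert x S) - f S := by
    refine Finset.exists_le_of_sum_le hO ?_
    rw [Finset.sum_const, nsmul_eq_mul, mul_div_cancel₀ _ hcard.ne']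
    exact union_sub_le_sum_insert_sub f hmono hsub S O
  refine ⟨x, hx, hgain, le_trans ?_ hgain⟩
  gcongr
  exact hmono O (O ∪ S) Finset.subset_union_left
end

section
/- Let ι be a finite type, f : Finset ι → ℝ monotone and submodular with f(∅) = 0, and let N ≥ 1. Let O be any finset of ι with |O| ≤ N, and let S₀ = ∅, S_{i+1} = insert x_i S_i where at each step x_i ∈ ι maximizes the marginal gain f(insert x S_i) - f(S_i) over all x ∈ ι. Then for every i, f(O) - f(S_{i+1}) ≤ (1 - 1/N) · (f(O) - f(S_i)). -/
/-- The gain of adding `T` to `A` under a submodular function is at most the sum of the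
marginal gains over `A` of the elements of `T`. -/
theorem submodular_union_sub_le_sum {ι : Type*} [DecidableEq ι] (f : Finset ι → ℝ)
    (hsub : ∀ S T : Finset ι, S ⊆ T → ∀ x ∉ T,
      f (insert x S) - f S ≥ f (insert x T) - f T)
    (A T : Finset ι) :
    f (A ∪ T) - f A ≤ ∑ y ∈ T, (f (insert y A) - f A) := by
  induction T using Finset.induction_on with
  | empty => simp
  | insert y T hy ih =>
    rw [Finset.sum_insert hy, Finset.union_insert]
    by_cases hA : y ∈ A
    · rw [Finset.insert_eq_of_mem hA, Finset.insert_eq_of_mem (Finset.mem_union_left T hA)]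
      linarith
    · have := hsub A (A ∪ T) Finset.subset_union_left y (by simp [hA, hy])
      linarith

/-- Contraction recurrence for the greedy algorithm on a monotone submodular function:
if at each step an element of maximal marginal gain is inserted, then the residual gap
to any finset `O` with `|O| ≤ N` contracts by a factor `1 - 1/N` at each step. -/
theorem greedy_contraction {ι : Type*} [Fintype ι] [DecidableEq ι]
    (f : Finset ι → ℝ)
    (hmono : ∀ S T : Finset ι, S ⊆ T → f S ≤ f T)
    (hsub : ∀ S T : Finset ι, S ⊆ T → ∀ x ∉ T,
      f (insert x S) - f S ≥ f (insert x T) - f T)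
    (hf0 : f ∅ = 0)
    (N : ℕ) (hN : 1 ≤ N)
    (O : Finset ι) (hO : O.card ≤ N)
    (S : ℕ → Finset ι) (x : ℕ → ι)
    (hS0 : S 0 = ∅)
    (hSsucc : ∀ i, S (i + 1) = insert (x i) (S i))
    (hgreedy : ∀ i, ∀ y : ι,
      f (insert y (S i)) - f (S i) ≤ f (insert (x i) (S i)) - f (S i)) :
    ∀ i, f O - f (S (i + 1)) ≤ (1 - 1 / (N : ℝ)) * (f O - f (S i)) := by
  intro i
  have hgain : 0 ≤ f (insert (x i) (S i)) - f (S i) :=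
    sub_nonneg.2 (hmono _ _ (Finset.subset_insert _ _))
  have hgap : f O - f (S i) ≤ N * (f (insert (x i) (S i)) - f (S i)) := calc
    f O - f (S i) ≤ f (S i ∪ O) - f (S i) :=
      sub_le_sub_right (hmono _ _ Finset.subset_union_right) _
    _ ≤ ∑ y ∈ O, (f (insert y (S i)) - f (S i)) := submodular_union_sub_le_sum f hsub _ _
    _ ≤ O.card • (f (insert (x i) (S i)) - f (S i)) :=
      Finset.sum_le_card_nsmul _ _ _ fun y _ => hgreedy i y
    _ ≤ N * (f (insert (x i) (S i)) - f (S i)) := by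
      rw [nsmul_eq_mul]
      gcongr
  have hN' : (0 : ℝ) < N := by exact_mod_cast hN
  have hdiv := (div_le_iff₀' hN').2 hgap
  rw [hSsucc, sub_mul, one_mul, one_div_mul_eq_div]
  linarith
end

section
/- Let ι be a finite type, f : Finset ι → ℝ monotone and submodular with f(∅) = 0, let N ≥ 1 and ε ≥ 0, and let O be a finset with |O| ≤ N and f(O) ≥ 0. Suppose S₀ = ∅ and S_{i+1} = insert x_i S_i for i < N, where each chosen x_i satisfies f(insert x_i S_i) - f(S_i) ≥ (f(O) - f(S_i))/N - ε·f(O)/N. Then f(O) - f(S_N) ≤ (((N-1)/N)^N + ε) · f(O); in particular (f(O) - f(S_N))/f(O) ≤ 1/e + ε whenever f(O) > 0. -/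
/-- A sequence satisfying `d (i + 1) ≤ c * d i + (1 - c) * b` for `i < N` and `d 0 ≤ a`, where
`0 ≤ c` and `0 ≤ b`, is bounded by `c ^ i * a + b`. -/
theorem le_pow_mul_add_of_affine_recursion {d : ℕ → ℝ} {a b c : ℝ} {N : ℕ}
    (hb : 0 ≤ b) (hc : 0 ≤ c) (h0 : d 0 ≤ a)
    (hd : ∀ i < N, d (i + 1) ≤ c * d i + (1 - c) * b) :
    ∀ i ≤ N, d i ≤ c ^ i * a + b := by
  intro i
  induction i with
  | zero => intro _; simpa using h0.trans (le_add_of_nonneg_right hb)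
  | succ i ih =>
    intro hi
    calc d (i + 1) ≤ c * d i + (1 - c) * b := hd i hi
      _ ≤ c * (c ^ i * a + b) + (1 - c) * b := by gcongr; exact ih (by omega)
      _ = c ^ (i + 1) * a + b := by ring

/-- Approximation guarantee for the approximate (stochastic) greedy algorithm on a
monotone submodular function with `f(∅) = 0`: if each of the `N` steps achieves marginal
gain at least `(f(O) - f(S_i))/N - ε·f(O)/N`, then
`f(O) - f(S_N) ≤ (((N-1)/N)^N + ε)·f(O)`, and in particular
`(f(O) - f(S_N))/f(O) ≤ 1/e + ε` whenever `f(O) > 0`. -/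
theorem stochastic_greedy_bound {ι : Type*} [Fintype ι] [DecidableEq ι]
    (f : Finset ι → ℝ)
    (hmono : ∀ S T : Finset ι, S ⊆ T → f S ≤ f T)
    (hsub : ∀ S T : Finset ι, S ⊆ T → ∀ x ∉ T,
      f (insert x S) - f S ≥ f (insert x T) - f T)
    (hf0 : f ∅ = 0)
    (N : ℕ) (hN : 1 ≤ N) (ε : ℝ) (hε : 0 ≤ ε)
    (O : Finset ι) (hO : O.card ≤ N) (hfO : 0 ≤ f O)
    (S : ℕ → Finset ι) (x : ℕ → ι)
    (hS0 : S 0 = ∅)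
    (hSsucc : ∀ i < N, S (i + 1) = insert (x i) (S i))
    (hgain : ∀ i < N,
      f (insert (x i) (S i)) - f (S i) ≥ (f O - f (S i)) / N - ε * f O / N) :
    f O - f (S N) ≤ ((((N : ℝ) - 1) / N) ^ N + ε) * f O ∧
      (0 < f O → (f O - f (S N)) / f O ≤ 1 / Real.exp 1 + ε) := by
  have hN0 : (0 : ℝ) < N := by exact_mod_cast hN
  have hN1 : (1 : ℝ) ≤ N := by exact_mod_cast hN
  have hbound : f O - f (S N) ≤ ((((N : ℝ) - 1) / N) ^ N + ε) * f O := by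
    rw [add_mul]
    refine le_pow_mul_add_of_affine_recursion (d := fun i ↦ f O - f (S i)) (N := N)
      (mul_nonneg hε hfO) (div_nonneg (sub_nonneg.2 hN1) hN0.le) ?_ ?_ N le_rfl
    · simp [hS0, hf0]
    · intro i hi
      have hstep := hgain i hi
      rw [← hSsucc i hi] at hstep
      have hrw : ((N : ℝ) - 1) / N * (f O - f (S i)) + (1 - ((N : ℝ) - 1) / N) * (ε * f O) =
          f O - f (S i) - ((f O - f (S i)) / N - ε * f O / N) := by
        field_simp
        ring
      simp only [hrw]
      linarith
  refine ⟨hbound, fun hpos ↦ ?_⟩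
  rw [div_le_iff₀ hpos]
  refine hbound.trans ?_
  gcongr
  rw [sub_div, div_self hN0.ne', one_div (Real.exp 1), ← Real.exp_neg]
  exact Real.one_sub_div_pow_le_exp_neg hN1
end
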